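/- Let G be a finite abelian group of order n ≥ 2. For any δ > 0 there exist ε > 0 and C > 0 (depending only on δ) such that there is a collection 𝓕_δ of subsets of G, each of size at least ε·n, with |𝓕_δ| ≤ exp(C·(log n)²), such that for every A ⊆ G with |A| ≥ δ·n, the sumset A + A contains some member F ∈ 𝓕_δ as a subset. -/

import Mathlib

open scoped Pointwise
open Finset

/-- Derandomised exponential moment bound: if the functions `Z i` have mean zero under the
probability weights `p` and satisfy `|Z i| ≤ 1`, `(Z i)² ≤ v`, then some `k`-tuple of them has
a total exponential moment at most `|X| exp (k v)`. -/
lemma exists_sum_exp_sum_le {ι X : Type*} [Fintype ι] [Fintype X] (p : ι → ℝ)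
    (hp0 : ∀ i, 0 ≤ p i) (hp1 : ∑ i, p i = 1) (Z : ι → X → ℝ)
    (hmean : ∀ x, ∑ i, p i * Z i x = 0) (hZ : ∀ i x, |Z i x| ≤ 1) (v : ℝ)
    (hv : ∀ i x, Z i x ^ 2 ≤ v) (k : ℕ) :
    ∃ s : Fin k → ι, ∑ x, Real.exp (∑ j, Z (s j) x) ≤ Fintype.card X * Real.exp (k * v) := by
  induction k with
  | zero => exact ⟨Fin.elim0, by simp⟩
  | succ k ih =>
    obtain ⟨s, hs⟩ := ih
    set W : X → ℝ := fun x => Real.exp (∑ j, Z (s j) x) with hW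
    have key : ∑ i, p i * ∑ x, Real.exp (Z i x) * W x ≤ ∑ i, p i * (Real.exp v * ∑ x, W x) := by
      calc ∑ i, p i * ∑ x, Real.exp (Z i x) * W x
          = ∑ x, (∑ i, p i * Real.exp (Z i x)) * W x := by
            simp only [Finset.mul_sum, Finset.sum_mul, ← mul_assoc]
            exact Finset.sum_comm
        _ ≤ ∑ x, Real.exp v * W x := by
            refine Finset.sum_le_sum fun x _ => ?_
            refine mul_le_mul_of_nonneg_right ?_ (Real.exp_pos _).le
            calc ∑ i, p i * Real.exp (Z i x) ≤ ∑ i, (p i * (1 + v) + p i * Z i x) := by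
                  refine Finset.sum_le_sum fun i _ => ?_
                  rw [← mul_add]
                  refine mul_le_mul_of_nonneg_left ?_ (hp0 i)
                  have h := (abs_le.1 (Real.abs_exp_sub_one_sub_id_le (hZ i x))).2
                  linarith [hv i x]
              _ = v + 1 := by
                  rw [Finset.sum_add_distrib, hmean, ← Finset.sum_mul, hp1]; ring
              _ ≤ Real.exp v := Real.add_one_le_exp v
        _ = ∑ i, p i * (Real.exp v * ∑ x, W x) := by
            rw [← Finset.sum_mul, hp1, one_mul, Finset.mul_sum]
    have hne : (univ : Finset ι).Nonempty := by
      by_contra h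
      rw [Finset.not_nonempty_iff_eq_empty] at h
      simp [h] at hp1
    obtain ⟨i, hi⟩ : ∃ i, ∑ x, Real.exp (Z i x) * W x ≤ Real.exp v * ∑ x, W x := by
      by_contra! h
      have hle : ∀ i ∈ (univ : Finset ι),
          p i * (Real.exp v * ∑ x, W x) ≤ p i * ∑ x, Real.exp (Z i x) * W x :=
        fun i _ => mul_le_mul_of_nonneg_left (h i).le (hp0 i)
      obtain ⟨i, -, hi⟩ : ∃ i ∈ (univ : Finset ι), 0 < p i := by
        apply Finset.exists_lt_of_sum_lt
        simp [hp1]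
      exact absurd key (not_le.2 (Finset.sum_lt_sum hle
        ⟨i, Finset.mem_univ _, mul_lt_mul_of_pos_left (h i) hi⟩))
    refine ⟨Fin.cons i s, ?_⟩
    calc ∑ x, Real.exp (∑ j, Z ((Fin.cons i s : Fin (k + 1) → ι) j) x)
        = ∑ x, Real.exp (Z i x) * W x := by
          simp [Fin.sum_univ_succ, Real.exp_add, hW]
      _ ≤ Real.exp v * (Fintype.card X * Real.exp (k * v)) :=
          hi.trans (mul_le_mul_of_nonneg_left hs (Real.exp_pos v).le)
      _ = Fintype.card X * Real.exp ((k + 1 : ℕ) * v) := by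
          push_cast
          rw [add_mul, one_mul, Real.exp_add]; ring

/-- Uniform approximation of a convex combination of functions bounded by `2` by the average of
logarithmically many of them. -/
lemma exists_abs_sum_sub_le {ι X : Type*} [Fintype ι] [Fintype X] (p : ι → ℝ)
    (hp0 : ∀ i, 0 ≤ p i) (hp1 : ∑ i, p i = 1) (φ : ι → X → ℝ) (hφ : ∀ i x, |φ i x| ≤ 2)
    (η : ℝ) (hη0 : 0 < η) (hη1 : η ≤ 1) (k : ℕ)
    (hk : 2 * (Fintype.card X : ℝ) ≤ Real.exp (k * (η ^ 2 / 64))) :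
    ∃ s : Fin k → ι, ∀ x, |∑ j, φ (s j) x - k * ∑ i, p i * φ i x| ≤ k * η := by
  set f : X → ℝ := fun x => ∑ i, p i * φ i x with hf
  have hf2 : ∀ x, |f x| ≤ 2 := fun x => by
    calc |f x| ≤ ∑ i, |p i * φ i x| := Finset.abs_sum_le_sum_abs _ _
      _ ≤ ∑ i, p i * 2 := by
        refine Finset.sum_le_sum fun i _ => ?_
        rw [abs_mul, abs_of_nonneg (hp0 i)]
        exact mul_le_mul_of_nonneg_left (hφ i x) (hp0 i)
      _ = 2 := by rw [← Finset.sum_mul, hp1, one_mul]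
  set σ : Bool → ℝ := fun b => if b then η / 32 else -(η / 32) with hσ
  have hσabs : ∀ b, |σ b| = η / 32 := fun b => by
    have : |η / 32| = η / 32 := abs_of_pos (by positivity)
    cases b <;> simp [hσ, this]
  have hbd : ∀ i (x : X × Bool), |σ x.2 * (φ i x.1 - f x.1)| ≤ η / 8 := fun i x => by
    rw [abs_mul, hσabs]
    have : |φ i x.1 - f x.1| ≤ 4 := by
      refine (abs_sub _ _).trans ?_
      linarith [hφ i x.1, hf2 x.1]
    nlinarith
  obtain ⟨s, hs⟩ := exists_sum_exp_sum_le p hp0 hp1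
    (fun i (x : X × Bool) => σ x.2 * (φ i x.1 - f x.1))
    (fun x => by
      have : ∀ i, p i * (σ x.2 * (φ i x.1 - f x.1))
          = σ x.2 * (p i * φ i x.1) - p i * (σ x.2 * f x.1) := fun i => by ring
      simp only [this]
      rw [Finset.sum_sub_distrib, ← Finset.mul_sum, ← Finset.sum_mul, hp1]
      simp [hf])
    (fun i x => (hbd i x).trans (by linarith)) (η ^ 2 / 64)
    (fun i x => by
      rw [← sq_abs]
      calc |σ x.2 * (φ i x.1 - f x.1)| ^ 2 ≤ (η / 8) ^ 2 :=
            pow_le_pow_left₀ (abs_nonneg _) (hbd i x) 2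
        _ = η ^ 2 / 64 := by ring) k
  have hone : ∀ x : X × Bool, σ x.2 * (∑ j, φ (s j) x.1 - k * f x.1) ≤ k * (η ^ 2 / 32) := by
    intro x
    rw [← Real.exp_le_exp]
    calc Real.exp (σ x.2 * (∑ j, φ (s j) x.1 - k * f x.1))
        = Real.exp (∑ j, σ x.2 * (φ (s j) x.1 - f x.1)) := by
          rw [← Finset.mul_sum, Finset.sum_sub_distrib]; simp
      _ ≤ ∑ x : X × Bool, Real.exp (∑ j, σ x.2 * (φ (s j) x.1 - f x.1)) :=
          Finset.single_le_sum
            (f := fun x : X × Bool => Real.exp (∑ j, σ x.2 * (φ (s j) x.1 - f x.1)))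
            (fun y _ => (Real.exp_pos _).le) (Finset.mem_univ x)
      _ ≤ 2 * (Fintype.card X : ℝ) * Real.exp (k * (η ^ 2 / 64)) := by
          refine hs.trans (le_of_eq ?_)
          simp [mul_comm]
      _ ≤ Real.exp (k * (η ^ 2 / 64)) * Real.exp (k * (η ^ 2 / 64)) :=
          mul_le_mul_of_nonneg_right hk (Real.exp_pos _).le
      _ = Real.exp (k * (η ^ 2 / 32)) := by rw [← Real.exp_add]; ring_nf
  refine ⟨s, fun x => ?_⟩
  have h1 := hone (x, true)
  have h2 := hone (x, false)
  simp only [hσ, if_true, Bool.false_eq_true, if_false] at h1 h2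
  rw [abs_le]
  constructor <;> nlinarith

/-- The same for combinations whose coefficients are signed and have absolute sum at most `2`;
the approximant is then an average of `0`, `±2` multiples of the functions. -/
lemma exists_signed_abs_sum_sub_le {ι X : Type*} [Fintype ι] [Nonempty ι] [Fintype X]
    (c : ι → ℝ) (hc : ∑ i, |c i| ≤ 2) (φ : ι → X → ℝ) (hφ : ∀ i x, |φ i x| ≤ 1)
    (η : ℝ) (hη0 : 0 < η) (hη1 : η ≤ 1) (k : ℕ)
    (hk : 2 * (Fintype.card X : ℝ) ≤ Real.exp (k * (η ^ 2 / 64))) :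
    ∃ s : Fin k → ι × SignType, ∀ x,
      |∑ j, 2 * ((s j).2 : ℝ) * φ (s j).1 x - k * ∑ i, c i * φ i x| ≤ k * η := by
  have hu : (univ : Finset SignType) = {0, -1, 1} := rfl
  set m : ℝ := (1 - (∑ i, |c i|) / 2) / Fintype.card ι with hm
  have hm0 : 0 ≤ m := div_nonneg (by linarith) (Nat.cast_nonneg _)
  have hcard : (Fintype.card ι : ℝ) ≠ 0 := Nat.cast_ne_zero.2 Fintype.card_ne_zero
  have hcm : Fintype.card ι * m = 1 - (∑ i, |c i|) / 2 := by
    rw [hm]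
    field_simp
  set p : ι × SignType → ℝ := fun q =>
    if q.2 = 0 then m else (|c q.1| + (q.2 : ℝ) * c q.1) / 4 with hp
  obtain ⟨s, hs⟩ := exists_abs_sum_sub_le p
    (fun q => by
      obtain ⟨i, θ⟩ := q
      have h1 := neg_abs_le (c i)
      have h2 := le_abs_self (c i)
      cases θ
      · simpa [hp] using hm0
      · simp [hp]; linarith
      · simp [hp]; linarith)
    (by
      have : ∀ i, ∑ θ, p (i, θ) = m + |c i| / 2 := fun i => by
        rw [hu]; simp [hp]; ring
      rw [Fintype.sum_prod_type]
      simp only [this]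
      rw [Finset.sum_add_distrib, Finset.sum_const, Finset.card_univ,
        nsmul_eq_mul, hcm, ← Finset.sum_div]
      ring)
    (fun q x => 2 * (q.2 : ℝ) * φ q.1 x)
    (fun q x => by
      obtain ⟨i, θ⟩ := q
      have := hφ i x
      cases θ <;> simp [abs_mul] <;> linarith) η hη0 hη1 k hk
  refine ⟨s, fun x => ?_⟩
  have : ∑ q, p q * (2 * (q.2 : ℝ) * φ q.1 x) = ∑ i, c i * φ i x := by
    rw [Fintype.sum_prod_type]
    refine Finset.sum_congr rfl fun i _ => ?_
    rw [hu]; simp [hp]; ring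
  rw [← this]
  exact hs x

section Fourier

variable {G : Type*} [AddCommGroup G]

/-- The number of representations of `x` as a sum of two elements of `A`. -/
def sumRep [DecidableEq G] (A : Finset G) (x : G) : ℕ := #{q ∈ A ×ˢ A | q.1 + q.2 = x}

lemma mem_add_of_sumRep_pos [DecidableEq G] {A : Finset G} {x : G} (h : 0 < sumRep A x) : x ∈ A + A := by
  obtain ⟨q, hq⟩ := Finset.card_pos.1 h
  simp only [Finset.mem_filter, Finset.mem_product] at hq
  exact Finset.mem_add.2 ⟨q.1, hq.1.1, q.2, hq.1.2, hq.2⟩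

variable [Fintype G]

/-- Real or imaginary part of a character. -/
noncomputable def charPart (i : AddChar G ℂ × Bool) (x : G) : ℝ :=
  if i.2 then (i.1 x).re else (i.1 x).im

lemma abs_charPart_le (i : AddChar G ℂ × Bool) (x : G) : |charPart i x| ≤ 1 := by
  have h := AddChar.norm_apply i.1 x
  unfold charPart
  split_ifs
  · exact h ▸ Complex.abs_re_le_norm _
  · exact h ▸ Complex.abs_im_le_norm _

variable [DecidableEq G]

/-- The squared Fourier coefficient of the indicator function of `A` at `ψ`. -/
noncomputable def fourierSq (A : Finset G) (ψ : AddChar G ℂ) : ℂ :=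
  ((∑ a ∈ A, ψ (-a)) / Fintype.card G) ^ 2

lemma sum_fourierSq_mul (A : Finset G) (x : G) :
    ∑ ψ, fourierSq A ψ * ψ x = (sumRep A x : ℂ) / Fintype.card G := by
  have hn : (Fintype.card G : ℂ) ≠ 0 := Nat.cast_ne_zero.2 Fintype.card_ne_zero
  have h1 : ∀ ψ : AddChar G ℂ, fourierSq A ψ * ψ x
      = (∑ q ∈ A ×ˢ A, ψ (x - (q.1 + q.2))) / (Fintype.card G : ℂ) ^ 2 := fun ψ => by
    rw [fourierSq, div_pow, div_mul_eq_mul_div, sq, Finset.sum_mul_sum, ← Finset.sum_product',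
      Finset.sum_mul]
    congr 1
    refine Finset.sum_congr rfl fun q _ => ?_
    rw [← AddChar.map_add_eq_mul, ← AddChar.map_add_eq_mul]
    congr 1
    abel
  simp only [h1]
  rw [← Finset.sum_div, Finset.sum_comm]
  simp only [AddChar.sum_apply_eq_ite]
  have h2 : ∀ q : G × G, (x - (q.1 + q.2) = 0) ↔ (q.1 + q.2 = x) := fun q => by
    rw [sub_eq_zero, eq_comm]
  simp only [h2]
  rw [← Finset.sum_filter, Finset.sum_const, nsmul_eq_mul, sumRep]
  field_simp

lemma sum_norm_fourierSq_le (A : Finset G) : ∑ ψ, ‖fourierSq A ψ‖ ≤ 1 := by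
  have hn0 : (0 : ℝ) < Fintype.card G := Nat.cast_pos.2 Fintype.card_pos
  have hn : (Fintype.card G : ℂ) ≠ 0 := Nat.cast_ne_zero.2 Fintype.card_ne_zero
  have h1 : ∀ ψ : AddChar G ℂ, ((‖fourierSq A ψ‖ : ℝ) : ℂ)
      = (∑ q ∈ A ×ˢ A, ψ (q.2 - q.1)) / (Fintype.card G : ℂ) ^ 2 := fun ψ => by
    rw [fourierSq, norm_pow, norm_div, div_pow, Complex.ofReal_div]
    push_cast
    rw [← Complex.mul_conj', map_sum, Finset.sum_mul_sum, ← Finset.sum_product']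
    congr 1
    · refine Finset.sum_congr rfl fun q _ => ?_
      rw [← AddChar.map_neg_eq_conj, ← AddChar.map_add_eq_mul]
      congr 1
      abel
    · simp
  have h2 : ((∑ ψ, ‖fourierSq A ψ‖ : ℝ) : ℂ) = ((#A / Fintype.card G : ℝ) : ℂ) := by
    push_cast
    simp only [h1]
    rw [← Finset.sum_div, Finset.sum_comm]
    simp only [AddChar.sum_apply_eq_ite, sub_eq_zero]
    rw [Finset.sum_product]
    simp
    field_simp
  rw [Complex.ofReal_inj.1 h2, div_le_one hn0]
  exact_mod_cast Finset.card_le_univ A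

/-- Coefficients of the representation function of `A` in the basis of parts of characters. -/
noncomputable def partCoeff (A : Finset G) (i : AddChar G ℂ × Bool) : ℝ :=
  if i.2 then (fourierSq A i.1).re else -(fourierSq A i.1).im

lemma sum_abs_partCoeff_le (A : Finset G) : ∑ i, |partCoeff A i| ≤ 2 := by
  rw [Fintype.sum_prod_type]
  calc ∑ ψ, ∑ b, |partCoeff A (ψ, b)| ≤ ∑ ψ, 2 * ‖fourierSq A ψ‖ := by
        refine Finset.sum_le_sum fun ψ _ => ?_
        have h1 := Complex.abs_re_le_norm (fourierSq A ψ)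
        have h2 := Complex.abs_im_le_norm (fourierSq A ψ)
        simp [partCoeff]
        linarith
    _ ≤ 2 := by
        rw [← Finset.mul_sum]
        linarith [sum_norm_fourierSq_le A]

lemma sum_partCoeff_mul (A : Finset G) (x : G) :
    ∑ i, partCoeff A i * charPart i x = (sumRep A x : ℝ) / Fintype.card G := by
  have h := congrArg Complex.re (sum_fourierSq_mul A x)
  rw [Complex.re_sum] at h
  have h2 : ((sumRep A x : ℂ) / Fintype.card G).re = (sumRep A x : ℝ) / Fintype.card G := by
    rw [← Complex.ofReal_natCast, ← Complex.ofReal_natCast, ← Complex.ofReal_div,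
      Complex.ofReal_re]
  rw [h2] at h
  rw [← h, Fintype.sum_prod_type]
  refine Finset.sum_congr rfl fun ψ _ => ?_
  simp [partCoeff, charPart, Complex.mul_re]
  ring

lemma sum_sumRep (A : Finset G) : ∑ x, sumRep A x = #A ^ 2 := by
  rw [sq, ← Finset.card_product]
  exact (Finset.card_eq_sum_card_fiberwise (f := fun q : G × G => q.1 + q.2)
    (t := univ) (fun _ _ => by simp)).symm

lemma sumRep_le_card (A : Finset G) (x : G) : sumRep A x ≤ Fintype.card G := by
  rw [← Finset.card_univ]
  refine Finset.card_le_card_of_injOn Prod.fst (fun _ _ => by simp) ?_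
  rintro ⟨a, b⟩ h ⟨a', b'⟩ h' (rfl : a = a')
  simp at h h'
  simpa using h.2.trans h'.2.symm

/-- The set where the average of a tuple of signed parts of characters is at least `τ`. -/
noncomputable def superlevel {k : ℕ} (τ : ℝ) (s : Fin k → (AddChar G ℂ × Bool) × SignType) :
    Finset G :=
  {x | k * τ ≤ ∑ j, 2 * ((s j).2 : ℝ) * charPart (s j).1 x}

lemma exists_superlevel_subset_add (δ : ℝ) (hδ0 : 0 < δ) (hδ1 : δ ≤ 1) (k : ℕ) (hk0 : 0 < k)
    (hk : 2 * (Fintype.card G : ℝ) ≤ Real.exp (k * ((δ ^ 2 / 4) ^ 2 / 64)))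
    (A : Finset G) (hA : δ * Fintype.card G ≤ #A) :
    ∃ s : Fin k → (AddChar G ℂ × Bool) × SignType,
      δ ^ 2 / 4 * Fintype.card G ≤ #(superlevel (δ ^ 2 / 2) s) ∧
        superlevel (δ ^ 2 / 2) s ⊆ A + A := by
  have hn0 : (0 : ℝ) < Fintype.card G := Nat.cast_pos.2 Fintype.card_pos
  have hk0' : (0 : ℝ) < k := Nat.cast_pos.2 hk0
  have hδ2 : 0 < δ ^ 2 := by positivity
  obtain ⟨s, hs⟩ := exists_signed_abs_sum_sub_le (partCoeff A) (sum_abs_partCoeff_le A)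
    charPart abs_charPart_le (δ ^ 2 / 4) (by positivity) (by nlinarith) k hk
  simp only [sum_partCoeff_mul] at hs
  refine ⟨s, ?_, fun x hx => ?_⟩
  · set F := superlevel (δ ^ 2 / 2) s with hF
    have hsum : ∑ x, (sumRep A x : ℝ) / Fintype.card G = (#A : ℝ) ^ 2 / Fintype.card G := by
      rw [← Finset.sum_div]
      congr 1
      exact_mod_cast sum_sumRep A
    have hup : ∀ x, (sumRep A x : ℝ) / Fintype.card G
        ≤ 3 * δ ^ 2 / 4 + if x ∈ F then 1 else 0 := fun x => by
      split_ifs with hx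
      · have : (sumRep A x : ℝ) / Fintype.card G ≤ 1 := by
          rw [div_le_one hn0]
          exact_mod_cast sumRep_le_card A x
        linarith
      · simp only [hF, superlevel, Finset.mem_filter, Finset.mem_univ, true_and, not_le] at hx
        have h := (abs_le.1 (hs x)).1
        have : (k : ℝ) * ((sumRep A x : ℝ) / Fintype.card G) ≤ k * (3 * δ ^ 2 / 4) := by
          linarith
        linarith [le_of_mul_le_mul_left this hk0']
    have htot := Finset.sum_le_sum fun x (_ : x ∈ (univ : Finset G)) => hup x
    rw [hsum, Finset.sum_add_distrib] at htot
    simp at htot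
    have hlow : δ ^ 2 * Fintype.card G ≤ (#A : ℝ) ^ 2 / Fintype.card G := by
      rw [le_div_iff₀ hn0]
      calc δ ^ 2 * Fintype.card G * Fintype.card G = (δ * Fintype.card G) ^ 2 := by ring
        _ ≤ (#A : ℝ) ^ 2 := pow_le_pow_left₀ (by positivity) hA 2
    linarith
  · simp only [superlevel, Finset.mem_filter, Finset.mem_univ, true_and] at hx
    have h := (abs_le.1 (hs x)).2
    have h3 : (k : ℝ) * (δ ^ 2 / 4) ≤ k * ((sumRep A x : ℝ) / Fintype.card G) := by linarith
    have h4 := le_of_mul_le_mul_left h3 hk0'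
    apply mem_add_of_sumRep_pos
    by_contra h0
    have h0' : sumRep A x = 0 := by omega
    rw [h0'] at h4
    simp at h4
    linarith

end Fourier

/-- resolution of Lovett's question. For every `δ > 0` there exist
`ε, C > 0` such that every finite abelian group `G` of order `n ≥ 2` admits a collection
`𝓕` of at most `exp(C (log n)²)` subsets, each of size at least `ε n`, such that the
sumset of every `A ⊆ G` with `|A| ≥ δ n` contains a member of `𝓕`. -/
theorem stmt4 :
    ∀ δ : ℝ, 0 < δ →
      ∃ ε C : ℝ, 0 < ε ∧ 0 < C ∧
        ∀ (G : Type) [AddCommGroup G] [Fintype G] [DecidableEq G],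
          2 ≤ Fintype.card G →
          ∃ 𝓕 : Finset (Finset G),
            (∀ F ∈ 𝓕, (F.card : ℝ) ≥ ε * Fintype.card G) ∧
            (𝓕.card : ℝ) ≤ Real.exp (C * Real.log (Fintype.card G) ^ 2) ∧
            ∀ A : Finset G, (A.card : ℝ) ≥ δ * Fintype.card G → ∃ F ∈ 𝓕, F ⊆ A + A := by
  intro δ₀ hδ₀
  obtain ⟨δ, hδ0, hδ1, hδle⟩ : ∃ δ : ℝ, 0 < δ ∧ δ ≤ 1 ∧ δ ≤ δ₀ :=
    ⟨min δ₀ 1, lt_min hδ₀ one_pos, min_le_right _ _, min_le_left _ _⟩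
  set r : ℝ := (δ ^ 2 / 4) ^ 2 / 64 with hr
  have hr0 : 0 < r := by positivity
  refine ⟨δ ^ 2 / 4, 4 * (2 / r + 2), by positivity, by positivity, ?_⟩
  intro G _ _ _ hG
  classical
  set n : ℝ := (Fintype.card G : ℝ) with hn
  have hn2 : (2 : ℝ) ≤ n := by rw [hn]; exact_mod_cast hG
  have hn0 : 0 < n := by linarith
  set L := Real.log n with hL
  have hlog2 : Real.log 2 ≤ L := Real.log_le_log (by norm_num) hn2
  have hL2 : 1 / 2 ≤ L := by linarith [Real.log_two_gt_d9]
  set k : ℕ := ⌈2 / r * L⌉₊ with hkdef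
  have hkpos : 0 < k := Nat.ceil_pos.2 (by positivity)
  have hklow : 2 / r * L ≤ k := Nat.le_ceil _
  have hkup : (k : ℝ) ≤ (2 / r + 2) * L := by
    have := (Nat.ceil_lt_add_one (show 0 ≤ 2 / r * L by positivity)).le
    linarith
  have hk : 2 * n ≤ Real.exp (k * r) := by
    rw [← Real.log_le_iff_le_exp (by positivity), Real.log_mul (by norm_num) hn0.ne']
    have : 2 * L ≤ k * r := by
      calc 2 * L = 2 / r * L * r := by field_simp
        _ ≤ k * r := mul_le_mul_of_nonneg_right hklow hr0.le
    linarith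
  refine ⟨(univ.image fun s : Fin k → (AddChar G ℂ × Bool) × SignType =>
    superlevel (δ ^ 2 / 2) s).filter fun F => δ ^ 2 / 4 * n ≤ #F, ?_, ?_, ?_⟩
  · intro F hF
    exact (Finset.mem_filter.1 hF).2
  · have hcard : (#((univ.image fun s : Fin k → (AddChar G ℂ × Bool) × SignType =>
        superlevel (δ ^ 2 / 2) s).filter fun F => δ ^ 2 / 4 * n ≤ #F) : ℝ) ≤ (n * 2 * 3) ^ k := by
      refine (Nat.cast_le.2 ((Finset.card_filter_le _ _).trans Finset.card_image_le)).trans ?_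
      have h3 : Fintype.card SignType = 3 := rfl
      simp [h3, AddChar.card_eq, hn]
    refine hcard.trans ?_
    have h6 : n * 2 * 3 ≤ Real.exp (4 * L) := by
      have : Real.exp (4 * L) = n ^ 4 := by
        rw [show 4 * L = ((4 : ℕ) : ℝ) * L by norm_num, Real.exp_nat_mul, hL, Real.exp_log hn0]
      rw [this]
      have h8 : (2 : ℝ) ^ 3 ≤ n ^ 3 := pow_le_pow_left₀ (by norm_num) hn2 3
      nlinarith
    calc (n * 2 * 3) ^ k ≤ Real.exp (4 * L) ^ k := pow_le_pow_left₀ (by positivity) h6 k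
      _ = Real.exp (k * (4 * L)) := (Real.exp_nat_mul _ _).symm
      _ ≤ Real.exp (4 * (2 / r + 2) * L ^ 2) := by
        rw [Real.exp_le_exp]
        calc (k : ℝ) * (4 * L) ≤ (2 / r + 2) * L * (4 * L) :=
              mul_le_mul_of_nonneg_right hkup (by positivity)
          _ = 4 * (2 / r + 2) * L ^ 2 := by ring
  · intro A hA
    obtain ⟨s, hs, hsub⟩ := exists_superlevel_subset_add δ hδ0 hδ1 k hkpos hk A
      ((mul_le_mul_of_nonneg_right hδle hn0.le).trans hA)
    exact ⟨_, Finset.mem_filter.2 ⟨Finset.mem_image_of_mem _ (Finset.mem_univ s), hs⟩, hsub⟩
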